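/- Let k ≥ 1 be an integer and let p be a prime such that S_k(x) is irreducible in 𝔽_p[x]. For m ∈ {p, p²}, in the finite ring R_m = (ℤ/mℤ)[x]/(S_k(x)), the images of the three elements x, x² − (k+1)x − 2, and −x² + kx + (k+2) are units of R_m and all three have multiplicative order equal to π(m), the period of the sequence (U_n) modulo m. -/

import Mathlib

open Polynomial

/-- The sequence `U₀ = U₁ = 0`, `U₂ = 1`,
`U_n = k·U_{n−1} + (k+3)·U_{n−2} + U_{n−3}` for `n ≥ 3`. -/
def shanksSeq (k : ℤ) : ℕ → ℤ
  | 0 => 0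
  | 1 => 0
  | 2 => 1
  | n + 3 => k * shanksSeq k (n + 2) + (k + 3) * shanksSeq k (n + 1) + shanksSeq k n

/-- `π(m)`: the least period of the sequence `(U_n)` modulo `m`. -/
noncomputable def shanksPeriod (k : ℤ) (m : ℕ) : ℕ :=
  sInf {n : ℕ | 0 < n ∧ ∀ j : ℕ, (shanksSeq k (j + n) : ZMod m) = (shanksSeq k j : ZMod m)}

/-- The Shanks polynomial over a commutative ring. -/
noncomputable abbrev shanksPoly {A : Type*} [CommRing A] (a : A) : A[X] :=
  X ^ 3 - C a * X ^ 2 - C (a + 3) * X - 1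

theorem shanksPoly_eq_toPoly {A : Type*} [CommRing A] (a : A) :
    shanksPoly a = Cubic.toPoly ⟨1, -a, -(a + 3), -1⟩ := by
  simp only [shanksPoly, Cubic.toPoly, map_neg, map_one]
  ring

theorem shanksPoly_monic {A : Type*} [CommRing A] (a : A) : (shanksPoly a).Monic := by
  rw [shanksPoly_eq_toPoly]
  exact Cubic.monic_of_a_eq_one'

theorem degree_shanksPoly {A : Type*} [CommRing A] [Nontrivial A] (a : A) :
    (shanksPoly a).degree = 3 := by
  rw [shanksPoly_eq_toPoly]
  exact Cubic.degree_of_a_ne_zero' one_ne_zero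

/-- The classes of `1`, `X`, `X ^ 2` are linearly independent modulo the Shanks polynomial. -/
theorem coeff_eq_zero_of_shanksPoly_dvd {A : Type*} [CommRing A] [Nontrivial A] {a r s t : A}
    (h : shanksPoly a ∣ C r * X ^ 2 + C s * X + C t) : r = 0 ∧ s = 0 ∧ t = 0 := by
  have hzero : C r * X ^ 2 + C s * X + C t = 0 := by
    by_contra hne
    refine (shanksPoly_monic a).not_dvd_of_degree_lt hne ?_ h
    rw [degree_shanksPoly]
    exact lt_of_le_of_lt degree_quadratic_le (by norm_num)
  have h2 := congrArg (coeff · 2) hzero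
  have h1 := congrArg (coeff · 1) hzero
  have h0 := congrArg (coeff · 0) hzero
  simp [coeff_X, coeff_C] at h2 h1 h0
  exact ⟨h2, h1, h0⟩

theorem shanksSeq_add_three (k : ℤ) (n : ℕ) :
    shanksSeq k (n + 3) =
      k * shanksSeq k (n + 2) + (k + 3) * shanksSeq k (n + 1) + shanksSeq k n := rfl

/-- Powers of a root of the Shanks polynomial in terms of the Shanks sequence. -/
theorem pow_succ_eq_shanksSeq {R : Type*} [CommRing R] (k : ℤ) {x : R}
    (hx : x ^ 3 = k * x ^ 2 + (k + 3) * x + 1) (n : ℕ) :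
    x ^ (n + 1) = shanksSeq k (n + 1) * x ^ 2 +
      (shanksSeq k (n + 2) - k * shanksSeq k (n + 1)) * x + shanksSeq k n := by
  induction n with
  | zero => simp [shanksSeq]
  | succ n ih =>
    rw [pow_succ, ih, shanksSeq_add_three]
    push_cast
    linear_combination (shanksSeq k (n + 1) : R) * hx

theorem shanksSeq_periodic_iff (k : ℤ) (m n : ℕ) :
    (∀ j : ℕ, (shanksSeq k (j + n) : ZMod m) = (shanksSeq k j : ZMod m)) ↔
      (shanksSeq k n : ZMod m) = 0 ∧ (shanksSeq k (n + 1) : ZMod m) = 0 ∧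
        (shanksSeq k (n + 2) : ZMod m) = 1 := by
  constructor
  · intro h
    have h0 := h 0
    have h1 := h 1
    have h2 := h 2
    rw [add_comm] at h0 h1 h2
    simpa [shanksSeq] using And.intro h0 (And.intro h1 h2)
  · rintro ⟨h0, h1, h2⟩ j
    suffices h : ∀ j : ℕ, (shanksSeq k (n + j) : ZMod m) = shanksSeq k j ∧
        (shanksSeq k (n + j + 1) : ZMod m) = shanksSeq k (j + 1) ∧
        (shanksSeq k (n + j + 2) : ZMod m) = shanksSeq k (j + 2) by
      rw [add_comm]
      exact (h j).1
    intro j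
    induction j with
    | zero => simpa [shanksSeq] using And.intro h0 (And.intro h1 h2)
    | succ j ih =>
      obtain ⟨i0, i1, i2⟩ := ih
      refine ⟨i1, i2, ?_⟩
      change (shanksSeq k (n + j + 3) : ZMod m) = shanksSeq k (j + 3)
      rw [shanksSeq_add_three, shanksSeq_add_three]
      push_cast
      rw [i0, i1, i2]

theorem orderOf_eq_sInf {G : Type*} [Monoid G] (x : G) :
    orderOf x = sInf {n : ℕ | 0 < n ∧ x ^ n = 1} := by
  by_cases h : {n : ℕ | 0 < n ∧ x ^ n = 1}.Nonempty
  · obtain ⟨hpos, hpow⟩ := Nat.sInf_mem h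
    obtain ⟨n, hn, hxn⟩ := h
    refine le_antisymm (orderOf_le_of_pow_eq_one hpos hpow) (Nat.sInf_le ⟨?_, pow_orderOf_eq_one x⟩)
    exact orderOf_pos_iff.2 (isOfFinOrder_iff_pow_eq_one.2 ⟨n, hn, hxn⟩)
  · rw [Set.not_nonempty_iff_eq_empty.1 h, Nat.sInf_empty, orderOf_eq_zero_iff']
    intro n hn hxn
    exact h ⟨n, hn, hxn⟩

section Quotient

variable (k : ℤ) (m : ℕ)

local notation "shanksRing" => (ZMod m)[X] ⧸ Ideal.span ({shanksPoly (k : ZMod m)} : Set (ZMod m)[X])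

local notation "π" => Ideal.Quotient.mk (Ideal.span ({shanksPoly (k : ZMod m)} : Set (ZMod m)[X]))

theorem shanksRing_root_pow_three :
    (π X) ^ 3 = (k : shanksRing) * (π X) ^ 2 + ((k : shanksRing) + 3) * (π X) + 1 := by
  have h : π (shanksPoly (k : ZMod m)) = 0 :=
    Ideal.Quotient.eq_zero_iff_mem.2 (Ideal.mem_span_singleton_self _)
  simp only [shanksPoly, map_sub, map_mul, map_pow, map_add, map_one, map_intCast, map_ofNat] at h
  linear_combination h

theorem shanksRing_root_pow_eq_one_iff [Nontrivial (ZMod m)] (n : ℕ) :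
    (π X) ^ n = 1 ↔
      ∀ j : ℕ, (shanksSeq k (j + n) : ZMod m) = (shanksSeq k j : ZMod m) := by
  have hx := shanksRing_root_pow_three k m
  have hpow := pow_succ_eq_shanksSeq k hx n
  rw [shanksSeq_periodic_iff]
  constructor
  · intro h
    have hmem : π (C (shanksSeq k (n + 1) : ZMod m) * X ^ 2 +
        C ((shanksSeq k (n + 2) : ZMod m) - k * shanksSeq k (n + 1) - 1) * X +
        C (shanksSeq k n : ZMod m)) = 0 := by
      simp only [map_add, map_sub, map_mul, map_pow, map_one, map_intCast]
      rw [pow_succ, h] at hpow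
      linear_combination -hpow
    obtain ⟨h2, h1, h0⟩ := coeff_eq_zero_of_shanksPoly_dvd
      (Ideal.mem_span_singleton.1 (Ideal.Quotient.eq_zero_iff_mem.1 hmem))
    refine ⟨h0, h2, ?_⟩
    linear_combination h1 + (k : ZMod m) * h2
  · rintro ⟨h0, h1, h2⟩
    have cast_eq : ∀ a b : ℤ, (a : ZMod m) = b → (a : shanksRing) = b := by
      intro a b hab
      simpa only [map_intCast] using congrArg (fun r => π (C r)) hab
    have e0 := cast_eq _ 0 (by simpa using h0)
    have e1 := cast_eq _ 0 (by simpa using h1)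
    have e2 := cast_eq _ 1 (by simpa using h2)
    rw [e0, e1, e2] at hpow
    push_cast at hpow
    linear_combination ((π X) ^ 2 - k * π X - (k + 3)) * hpow + (1 - (π X) ^ n) * hx

theorem orderOf_shanksRing_root [Nontrivial (ZMod m)] : orderOf (π X) = shanksPeriod k m := by
  simp only [orderOf_eq_sInf, shanksPeriod, shanksRing_root_pow_eq_one_iff]

/-- Every root in the quotient ring is the image of the class of `X` under an endomorphism. -/
theorem exists_shanksRing_end {y : shanksRing}
    (hy : y ^ 3 = (k : shanksRing) * y ^ 2 + ((k : shanksRing) + 3) * y + 1) :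
    ∃ f : shanksRing →+* shanksRing, f (π X) = y := by
  refine ⟨Ideal.Quotient.lift _ (eval₂RingHom ((π).comp C) y) ?_, ?_⟩
  · intro q hq
    obtain ⟨r, rfl⟩ := Ideal.mem_span_singleton.1 hq
    rw [map_mul]
    convert zero_mul _
    simp only [shanksPoly, map_sub, map_mul, map_pow, map_add, map_one, map_intCast, map_ofNat,
      coe_eval₂RingHom, eval₂_X]
    linear_combination hy
  · simp

end Quotient

/-- Let `k ≥ 1` and let `p` be a prime such that the Shanks
polynomial `S_k(x) = x³ − k·x² − (k+3)·x − 1` is irreducible in `𝔽_p[x]`.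
For `m ∈ {p, p²}`, in the finite ring `R_m = (ℤ/mℤ)[x]/(S_k(x))`, the images of
`x`, `x² − (k+1)x − 2` and `−x² + kx + (k+2)` are units of `R_m`, all of
multiplicative order `π(m)`. -/
theorem shanks_roots_order (k : ℤ) (hk : 1 ≤ k) (p : ℕ) (hp : p.Prime)
    (hirr : Irreducible (X ^ 3 - C (k : ZMod p) * X ^ 2 - C ((k : ZMod p) + 3) * X - 1)) :
    ∀ m : ℕ, m = p ∨ m = p ^ 2 →
      (IsUnit (Ideal.Quotient.mk (Ideal.span ({X ^ 3 - C (k : ZMod m) * X ^ 2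
          - C ((k : ZMod m) + 3) * X - 1} : Set (ZMod m)[X])) X) ∧
        orderOf (Ideal.Quotient.mk (Ideal.span ({X ^ 3 - C (k : ZMod m) * X ^ 2
          - C ((k : ZMod m) + 3) * X - 1} : Set (ZMod m)[X])) X) = shanksPeriod k m) ∧
      (IsUnit (Ideal.Quotient.mk (Ideal.span ({X ^ 3 - C (k : ZMod m) * X ^ 2
          - C ((k : ZMod m) + 3) * X - 1} : Set (ZMod m)[X]))
          (X ^ 2 - C ((k : ZMod m) + 1) * X - 2)) ∧
        orderOf (Ideal.Quotient.mk (Ideal.span ({X ^ 3 - C (k : ZMod m) * X ^ 2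
          - C ((k : ZMod m) + 3) * X - 1} : Set (ZMod m)[X]))
          (X ^ 2 - C ((k : ZMod m) + 1) * X - 2)) = shanksPeriod k m) ∧
      (IsUnit (Ideal.Quotient.mk (Ideal.span ({X ^ 3 - C (k : ZMod m) * X ^ 2
          - C ((k : ZMod m) + 3) * X - 1} : Set (ZMod m)[X]))
          (-X ^ 2 + C (k : ZMod m) * X + C ((k : ZMod m) + 2))) ∧
        orderOf (Ideal.Quotient.mk (Ideal.span ({X ^ 3 - C (k : ZMod m) * X ^ 2
          - C ((k : ZMod m) + 3) * X - 1} : Set (ZMod m)[X]))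
          (-X ^ 2 + C (k : ZMod m) * X + C ((k : ZMod m) + 2))) = shanksPeriod k m) := by
  intro m hm
  have hm1 : 1 < m := by
    rcases hm with rfl | rfl
    · exact hp.one_lt
    · exact Nat.one_lt_pow two_ne_zero hp.one_lt
  have : Fact (1 < m) := ⟨hm1⟩
  have hx := shanksRing_root_pow_three k m
  have hord := orderOf_shanksRing_root k m
  simp only [map_add, map_sub, map_neg, map_mul, map_pow, map_intCast, map_ofNat, map_one]
  set x := Ideal.Quotient.mk (Ideal.span ({shanksPoly (k : ZMod m)} : Set (ZMod m)[X])) X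
  set y := x ^ 2 - (k + 1) * x - 2 with hy
  set z := -x ^ 2 + k * x + (k + 2) with hz
  have hxyz : x * y * z = 1 := by
    rw [hy, hz]
    linear_combination (-x ^ 2 + x * k + x + 1) * hx
  obtain ⟨f, hfx⟩ := exists_shanksRing_end k m (y := y) (by
    rw [hy]
    linear_combination (x ^ 3 - 2 * x ^ 2 * k - 3 * x ^ 2 + x * k ^ 2 + 3 * x * k + 2 * k + 3) * hx)
  change f x = y at hfx
  have hfy : f y = z := by
    rw [hy]
    simp only [map_sub, map_mul, map_pow, map_add, map_one, map_intCast, map_ofNat, hfx]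
    rw [hy, hz]
    linear_combination (x - k - 2) * hx
  have hfz : f z = x := by
    rw [hz]
    simp only [map_neg, map_mul, map_pow, map_add, map_intCast, map_ofNat, hfx]
    rw [hy]
    linear_combination (-x + k + 2) * hx
  have hdvd (w) : orderOf (f w) ∣ orderOf w := orderOf_map_dvd f.toMonoidHom w
  have hyx : orderOf y ∣ orderOf x := hfx ▸ hdvd x
  have hzy : orderOf z ∣ orderOf y := hfy ▸ hdvd y
  have hxz : orderOf x ∣ orderOf z := hfz ▸ hdvd z
  refine ⟨⟨.of_mul_eq_one (y * z) (by rw [← hxyz]; ring), hord⟩,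
    ⟨.of_mul_eq_one (x * z) (by rw [← hxyz]; ring), ?_⟩,
    ⟨.of_mul_eq_one (x * y) (by rw [← hxyz]; ring), ?_⟩⟩
  · rw [← hord]
    exact Nat.dvd_antisymm hyx (hxz.trans hzy)
  · rw [← hord]
    exact Nat.dvd_antisymm (hzy.trans hyx) hxz
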